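/- Let (R, m) be a one-dimensional Cohen-Macaulay local Arf domain, and suppose that the integral closure R̄ of R in its fraction field is a local ring and is finitely generated as an R-module. Then there are, up to isomorphism, only finitely many indecomposable finitely generated reflexive R-modules; equivalently, there are only finitely many isomorphism classes of indecomposable modules M fitting in an exact sequence 0 → M → F → X → 0 with F a finitely generated free R-module and X a maximal Cohen-Macaulay R-module (i.e., indecomposable first syzygies of maximal Cohen-Macaulay modules). -/

import Mathlib

set_option synthInstance.maxHeartbeats 1000000
set_option maxHeartbeats 4000000

/-- `x` is integral over the ideal `I`: there are `n ≥ 1` and `a_i ∈ I^i` with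
`x^n + a_1 x^{n-1} + ... + a_n = 0`. -/
def IsIntegralOverIdeal {R : Type*} [CommRing R] (I : Ideal R) (x : R) : Prop :=
  ∃ n : ℕ, 0 < n ∧ ∃ a : ℕ → R, (∀ i, 1 ≤ i → i ≤ n → a i ∈ I ^ i) ∧
    x ^ n + ∑ i ∈ Finset.Icc 1 n, a i * x ^ (n - i) = 0

/-- An ideal is integrally closed if it contains every element integral over it. -/
def IsIntegrallyClosedIdeal {R : Type*} [CommRing R] (I : Ideal R) : Prop :=
  ∀ x : R, IsIntegralOverIdeal I x → x ∈ I

/-- A ring `R` is an Arf ring if for every integrally closed ideal `I` of `R` containing a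
nonzerodivisor there exists `a ∈ I` with `I² = aI`. -/
def IsArfRing (R : Type*) [CommRing R] : Prop :=
  ∀ I : Ideal R, IsIntegrallyClosedIdeal I → (∃ x ∈ I, x ∈ nonZeroDivisors R) →
    ∃ a ∈ I, I ^ 2 = Ideal.span {a} * I

/-- A nonzero module `M` is indecomposable if it is not the (internal) direct sum of two
nonzero submodules. -/
def IsIndecomposableModule (R M : Type*) [CommRing R] [AddCommGroup M] [Module R M] : Prop :=
  Nontrivial M ∧ ∀ M₁ M₂ : Submodule R M, IsCompl M₁ M₂ → M₁ = ⊥ ∨ M₂ = ⊥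

/-- Over a one-dimensional Cohen-Macaulay local ring, a maximal Cohen-Macaulay module is a
nonzero finitely generated module on which some element of the maximal ideal acts as a
nonzerodivisor. -/
def IsMCM (R M : Type*) [CommRing R] [IsLocalRing R] [AddCommGroup M] [Module R M] : Prop :=
  Nontrivial M ∧ Module.Finite R M ∧
    ∃ x ∈ IsLocalRing.maximalIdeal R, ∀ y : M, x • y = 0 → y = 0

/-- The ideal of elements of `R` whose image in `V` is divisible by `ϖ ^ n`. -/
def powDvdIdeal (R : Type*) {V : Type*} [CommRing R] [CommRing V] [Algebra R V] (ϖ : V) (n : ℕ) :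
    Ideal R :=
  (Ideal.span {ϖ ^ n}).comap (algebraMap R V)

theorem mem_powDvdIdeal {R V : Type*} [CommRing R] [CommRing V] [Algebra R V] {ϖ : V} {n : ℕ}
    {x : R} : x ∈ powDvdIdeal R ϖ n ↔ ϖ ^ n ∣ algebraMap R V x := by
  rw [powDvdIdeal, Ideal.mem_comap, Ideal.mem_span_singleton]

theorem dvd_of_mem_powDvdIdeal_pow {R V : Type*} [CommRing R] [CommRing V] [Algebra R V] {ϖ : V}
    {n i : ℕ} {x : R} (hx : x ∈ powDvdIdeal R ϖ n ^ i) : ϖ ^ (n * i) ∣ algebraMap R V x := by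
  have h : algebraMap R V x ∈ Ideal.span {ϖ ^ n} ^ i :=
    Ideal.le_comap_pow (algebraMap R V) i hx
  rwa [Ideal.span_singleton_pow, Ideal.mem_span_singleton, ← pow_mul] at h

theorem isIntegrallyClosedIdeal_powDvdIdeal {R V : Type*} [CommRing R] [CommRing V] [IsDomain V]
    [IsDiscreteValuationRing V] [Algebra R V] {ϖ : V} (hϖ : Irreducible ϖ) (n : ℕ) :
    IsIntegrallyClosedIdeal (powDvdIdeal R ϖ n) := by
  rintro x ⟨N, hN, a, ha, hx⟩
  rw [mem_powDvdIdeal]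
  by_cases hx0 : algebraMap R V x = 0
  · simp [hx0]
  obtain ⟨k, u, hk⟩ := IsDiscreteValuationRing.eq_unit_mul_pow_irreducible hx0 hϖ
  by_contra hndvd
  have hkn : k < n := by
    by_contra! h
    exact hndvd (hk ▸ (pow_dvd_pow ϖ h).mul_left _)
  have hsum : ϖ ^ (k * N + 1) ∣ algebraMap R V (∑ i ∈ Finset.Icc 1 N, a i * x ^ (N - i)) := by
    rw [map_sum]
    refine Finset.dvd_sum fun i hi => ?_
    rw [Finset.mem_Icc] at hi
    obtain ⟨j, rfl⟩ := Nat.exists_eq_add_of_le hi.2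
    rw [map_mul, map_pow, hk, Nat.add_sub_cancel_left]
    have h1 : ϖ ^ (k * i + 1) ∣ algebraMap R V (a i) :=
      (pow_dvd_pow ϖ (by nlinarith)).trans (dvd_of_mem_powDvdIdeal_pow (ha i hi.1 hi.2))
    have h2 : ϖ ^ (k * j) ∣ (↑u * ϖ ^ k) ^ j := by
      rw [mul_pow, ← pow_mul]
      exact dvd_mul_left _ _
    have h3 := mul_dvd_mul h1 h2
    rwa [← pow_add, show k * i + 1 + k * j = k * (i + j) + 1 by ring] at h3
  have hpow : ϖ ^ (k * N + 1) ∣ algebraMap R V x ^ N := by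
    rw [← map_pow, eq_neg_of_add_eq_zero_left hx, map_neg]
    exact hsum.neg_right
  rw [hk, mul_pow, ← pow_mul, ← Units.val_pow_eq_pow_val, Units.dvd_mul_left,
    pow_dvd_pow_iff hϖ.ne_zero hϖ.not_isUnit] at hpow
  omega

/-- If `I² = aI`, then the elements of `a⁻¹ I` form a subring of any field containing `R`. -/
def divSubalgebra {R : Type*} (L : Type*) [CommRing R] [Field L] [Algebra R L] [FaithfulSMul R L]
    (I : Ideal R) (a : R) (ha : a ∈ I) (ha0 : a ≠ 0) (hI : I ^ 2 = Ideal.span {a} * I) :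
    Subalgebra R L where
  carrier := {s | ∃ i ∈ I, algebraMap R L a * s = algebraMap R L i}
  mul_mem' := by
    rintro s t ⟨i, hi, hs⟩ ⟨j, hj, ht⟩
    have h : i * j ∈ I ^ 2 := by
      rw [pow_two]
      exact Ideal.mul_mem_mul hi hj
    rw [hI, Ideal.mem_span_singleton_mul] at h
    obtain ⟨l, hl, h⟩ := h
    refine ⟨l, hl, mul_left_cancel₀
      ((FaithfulSMul.algebraMap_injective R L).ne_iff' (map_zero _) |>.mpr ha0) ?_⟩
    rw [← map_mul _ a l, h, map_mul, ← hs, ← ht]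
    ring
  add_mem' := by
    rintro s t ⟨i, hi, hs⟩ ⟨j, hj, ht⟩
    exact ⟨i + j, I.add_mem hi hj, by rw [mul_add, hs, ht, map_add]⟩
  algebraMap_mem' r := ⟨a * r, I.mul_mem_right r ha, (map_mul _ _ _).symm⟩

theorem IsIntegral.mem_subalgebra_of_inv_mem {R L : Type*} [CommRing R] [Field L] [Algebra R L]
    {x : L} (hx : IsIntegral R x) {S : Subalgebra R L} (hinv : x⁻¹ ∈ S) : x ∈ S := by
  by_cases hx0 : x = 0
  · simp [hx0]
  obtain ⟨p, hp, h⟩ := hx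
  rw [← Polynomial.aeval_def, Polynomial.aeval_eq_sum_range, Finset.sum_range_succ,
    hp.coeff_natDegree, one_smul] at h
  cases hn : p.natDegree with
  | zero => simp [hn] at h
  | succ m =>
    rw [hn] at h
    have hxm : x = -(∑ i ∈ Finset.range (m + 1), p.coeff i • x ^ i) * x⁻¹ ^ m := by
      rw [← eq_neg_of_add_eq_zero_right h, inv_pow]
      field_simp
      ring
    rw [hxm, neg_mul, Finset.sum_mul]
    refine S.neg_mem (S.sum_mem fun i hi => ?_)
    obtain ⟨j, rfl⟩ := Nat.exists_eq_add_of_le (Nat.lt_succ_iff.mp (Finset.mem_range.mp hi))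
    rw [smul_mul_assoc, pow_add, ← mul_assoc, inv_pow, mul_inv_cancel₀ (pow_ne_zero i hx0), one_mul]
    exact S.smul_mem (S.pow_mem hinv j) _

theorem dvd_mul_of_sq_eq_span_mul {R L : Type*} [CommRing R] [Field L] [Algebra R L]
    [FaithfulSMul R L] {I : Ideal R} {a b : R} (ha : a ∈ I) (ha0 : a ≠ 0)
    (hI : I ^ 2 = Ideal.span {a} * I) (hb : b ∈ I) (hb0 : b ≠ 0)
    (hint : IsIntegral R (algebraMap R L a / algebraMap R L b)) {z w : R} (hz : z ∈ I)
    (hw : w ∈ I) : b ∣ z * w := by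
  have hinj := FaithfulSMul.algebraMap_injective R L
  have ha' : algebraMap R L a ≠ 0 := (hinj.ne_iff' (map_zero _)).mpr ha0
  have hb' : algebraMap R L b ≠ 0 := (hinj.ne_iff' (map_zero _)).mpr hb0
  have h : z * w ∈ I ^ 2 := by
    rw [pow_two]
    exact Ideal.mul_mem_mul hz hw
  rw [hI, Ideal.mem_span_singleton_mul] at h
  obtain ⟨y, hy, h⟩ := h
  let S := divSubalgebra L I a ha ha0 hI
  have hu : algebraMap R L b / algebraMap R L a ∈ S := ⟨b, hb, mul_div_cancel₀ _ ha'⟩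
  have hs : algebraMap R L y / algebraMap R L a ∈ S := ⟨y, hy, mul_div_cancel₀ _ ha'⟩
  obtain ⟨i, -, hi⟩ := S.mul_mem (hint.mem_subalgebra_of_inv_mem (inv_div _ (algebraMap R L b) ▸ hu))
    hs
  refine ⟨i, hinj ?_⟩
  rw [← h, map_mul, map_mul, ← hi]
  field_simp

theorem LinearMap.exists_comp_eq_of_range_le {R A B C : Type*} [CommRing R] [AddCommGroup A]
    [AddCommGroup B] [AddCommGroup C] [Module R A] [Module R B] [Module R C] (f : A →ₗ[R] B)
    (g : C →ₗ[R] B) (hg : Function.Injective g) (h : LinearMap.range f ≤ LinearMap.range g) :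
    ∃ k : A →ₗ[R] C, ∀ x, g (k x) = f x := by
  refine ⟨(LinearEquiv.ofInjective g hg).symm.toLinearMap ∘ₗ
    f.codRestrict (LinearMap.range g) (fun x => h ⟨x, rfl⟩), fun x => ?_⟩
  rw [← LinearEquiv.ofInjective_apply (h := hg) g]
  simp

/-- The functionals on `M` separate points, and they detect divisibility by nonzero scalars.
This holds for reflexive modules and for first syzygies of torsion-free modules. -/
structure IsDualDivisible (R M : Type*) [CommRing R] [AddCommGroup M] [Module R M] : Prop where
  eq_zero : ∀ x : M, (∀ f : Module.Dual R M, f x = 0) → x = 0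
  exists_smul_eq : ∀ (x : M) (r : R), r ≠ 0 → (∀ f : Module.Dual R M, r ∣ f x) → ∃ y, r • y = x

theorem IsDualDivisible.of_isReflexive {R M : Type*} [CommRing R] [IsDomain R] [AddCommGroup M]
    [Module R M] [Module.IsReflexive R M] : IsDualDivisible R M := by
  have hinj := (Module.bijective_dual_eval R M).1
  have hzero : ∀ x : M, (∀ f : Module.Dual R M, f x = 0) → x = 0 := fun x hx =>
    hinj (by ext f; simpa using hx f)
  refine ⟨hzero, fun x r hr hx => ?_⟩
  obtain ⟨φ, hφ⟩ := LinearMap.exists_comp_eq_of_range_le (Module.Dual.eval R M x)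
    (LinearMap.mulLeft R r) (fun a b h => mul_left_cancel₀ hr h) (by
      rintro _ ⟨f, rfl⟩
      obtain ⟨s, hs⟩ := hx f
      exact ⟨s, hs.symm⟩)
  obtain ⟨y, rfl⟩ := (Module.bijective_dual_eval R M).2 φ
  refine ⟨y, sub_eq_zero.mp (hzero _ fun f => ?_)⟩
  have := hφ f
  simp only [LinearMap.mulLeft_apply, Module.Dual.eval_apply] at this
  simp [this]

theorem IsDualDivisible.of_exact {R M F X : Type*} [CommRing R] [AddCommGroup M] [Module R M]
    [AddCommGroup F] [Module R F] [Module.Free R F] [AddCommGroup X] [Module R X]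
    (hX : ∀ (r : R) (x : X), r ≠ 0 → r • x = 0 → x = 0) (f : M →ₗ[R] F) (g : F →ₗ[R] X)
    (hf : Function.Injective f) (hfg : LinearMap.range f = LinearMap.ker g) :
    IsDualDivisible R M := by
  let b := Module.Free.chooseBasis R F
  refine ⟨fun x hx => hf ?_, fun x r hr hx => ?_⟩
  · rw [map_zero]
    exact b.ext_elem_iff.mpr fun i => by simpa using hx (b.coord i ∘ₗ f)
  · choose c hc using fun i => hx (b.coord i ∘ₗ f)
    have hsupp : ∃ y : F, r • y = f x := by
      refine ⟨∑ i ∈ (b.repr (f x)).support, c i • b i, ?_⟩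
      conv_rhs => rw [← b.linearCombination_repr (f x), Finsupp.linearCombination_apply,
        Finsupp.sum]
      rw [Finset.smul_sum]
      refine Finset.sum_congr rfl fun i _ => ?_
      rw [smul_smul, ← hc]
      rfl
    obtain ⟨y, hy⟩ := hsupp
    have hgy : g y = 0 := by
      refine hX r _ hr ?_
      rw [← map_smul, hy]
      exact LinearMap.mem_ker.mp (hfg ▸ LinearMap.mem_range_self f x)
    obtain ⟨z, rfl⟩ : y ∈ LinearMap.range f := hfg ▸ LinearMap.mem_ker.mpr hgy
    exact ⟨z, hf (by rw [map_smul, hy])⟩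

theorem IsMCM.eq_zero_of_smul_eq_zero {R X : Type*} [CommRing R] [IsDomain R] [IsLocalRing R]
    [Ring.DimensionLEOne R] [AddCommGroup X] [Module R X] (h : IsMCM R X) (r : R) (x : X)
    (hr : r ≠ 0) (hx : r • x = 0) : x = 0 := by
  obtain ⟨-, -, t, ht, hreg⟩ := h
  have hrad : t ∈ (Ideal.span {r}).radical := by
    rw [Ideal.radical_eq_sInf, Ideal.mem_sInf]
    rintro p ⟨hle, hp⟩
    have hne : p ≠ ⊥ := fun h0 => hr (by
      have := hle (Ideal.mem_span_singleton_self r)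
      rwa [h0, Ideal.mem_bot] at this)
    have := hp.isMaximal hne
    rwa [IsLocalRing.eq_maximalIdeal this]
  obtain ⟨k, hk⟩ := hrad
  obtain ⟨s, hs⟩ := Ideal.mem_span_singleton.mp hk
  have hpow : ∀ k : ℕ, t ^ k • x = 0 → x = 0 := by
    intro k
    induction k with
    | zero => simp
    | succ k ih =>
      intro h
      exact ih (hreg _ (by rwa [smul_smul, ← pow_succ']))
  exact hpow k (by rw [hs, mul_comm, mul_smul, hx, smul_zero])

theorem IsDualDivisible.nonempty_linearEquiv_of_dvd {R M : Type*} [CommRing R] [IsDomain R]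
    [AddCommGroup M] [Module R M] (hM : IsDualDivisible R M) (hind : IsIndecomposableModule R M)
    {I : Ideal R} (f₀ : Module.Dual R M) (x₀ : M) (h0 : f₀ x₀ ≠ 0)
    (hI : ∀ (f : Module.Dual R M) x, f x ∈ I)
    (hdvd : ∀ z ∈ I, ∀ w ∈ I, f₀ x₀ ∣ z * w) : Nonempty (M ≃ₗ[R] I) := by
  have htf : ∀ (r : R) (y : M), r ≠ 0 → r • y = 0 → y = 0 := fun r y hr hy =>
    hM.eq_zero y fun f => by
      have : r * f y = 0 := by rw [← smul_eq_mul, ← map_smul, hy, map_zero]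
      exact (mul_eq_zero.mp this).resolve_left hr
  have hdiv : ∀ z ∈ I, ∃ y, f₀ x₀ • y = z • x₀ := fun z hz =>
    hM.exists_smul_eq _ _ h0 fun f => by simpa using hdvd z hz _ (hI f x₀)
  have hval : ∀ (z : R) (y : M), f₀ x₀ • y = z • x₀ → f₀ y = z := fun z y h => by
    have := congrArg f₀ h
    rw [map_smul, map_smul, smul_eq_mul, smul_eq_mul, mul_comm z] at this
    exact mul_left_cancel₀ h0 this
  let P : Submodule R M :=
    { carrier := {y | f₀ x₀ • y = f₀ y • x₀}
      add_mem' := fun {y z} hy hz => by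
        simp only [Set.mem_ofPred_eq] at *
        rw [smul_add, hy, hz, map_add, add_smul]
      zero_mem' := by simp
      smul_mem' := fun r y hy => by
        simp only [Set.mem_ofPred_eq] at *
        rw [smul_comm, hy, map_smul, smul_smul, smul_eq_mul] }
  have hcompl : IsCompl (LinearMap.ker f₀) P := by
    rw [isCompl_iff, Submodule.disjoint_def, codisjoint_iff, Submodule.eq_top_iff']
    refine ⟨fun y hy hyP => ?_, fun y => ?_⟩
    · have h : f₀ x₀ • y = f₀ y • x₀ := hyP
      rw [LinearMap.mem_ker.mp hy, zero_smul] at h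
      exact htf _ _ h0 h
    · obtain ⟨y', hy'⟩ := hdiv _ (hI f₀ y)
      have hv := hval _ _ hy'
      refine Submodule.mem_sup.mpr ⟨y - y', by simp [hv], y', ?_, sub_add_cancel _ _⟩
      change f₀ x₀ • y' = f₀ y' • x₀
      rw [hy', hv]
  have hP : P ≠ ⊥ := fun h => h0 (by
    have : x₀ ∈ P := rfl
    rw [h, Submodule.mem_bot] at this
    rw [this, map_zero])
  have hker := (hind.2 _ _ hcompl).resolve_right hP
  refine ⟨LinearEquiv.ofBijective (f₀.codRestrict I (hI f₀)) ⟨?_, ?_⟩⟩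
  · rw [← LinearMap.ker_eq_bot, LinearMap.ker_codRestrict, hker]
  · rintro ⟨z, hz⟩
    obtain ⟨y, hy⟩ := hdiv z hz
    exact ⟨y, Subtype.ext (hval z y hy)⟩

theorem IsDualDivisible.exists_linearEquiv_powDvdIdeal {R V M : Type*} [CommRing R] [IsDomain R]
    [CommRing V] [IsDomain V] [IsDiscreteValuationRing V] [Algebra R V] [FaithfulSMul R V]
    [Algebra.IsIntegral R V] (hArf : IsArfRing R) {ϖ : V} (hϖ : Irreducible ϖ)
    [AddCommGroup M] [Module R M] (hM : IsDualDivisible R M)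
    (hind : IsIndecomposableModule R M) : ∃ n, Nonempty (M ≃ₗ[R] powDvdIdeal R ϖ n) := by
  have hinj := FaithfulSMul.algebraMap_injective R V
  let ν : Module.Dual R M × M → ℕ∞ := fun p =>
    IsDiscreteValuationRing.addVal V (algebraMap R V (p.1 p.2))
  obtain ⟨⟨f₀, x₀⟩, -, hmin⟩ := WellFounded.has_min (InvImage.wf ν wellFounded_lt) Set.univ
    ⟨0, trivial⟩
  have hmin' : ∀ (f : Module.Dual R M) x, algebraMap R V (f₀ x₀) ∣ algebraMap R V (f x) :=
    fun f x => IsDiscreteValuationRing.addVal_le_iff_dvd.mp (not_lt.mp (hmin (f, x) trivial))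
  have h0 : f₀ x₀ ≠ 0 := by
    intro h
    obtain ⟨x, hx⟩ := @exists_ne M hind.1 0
    refine hx (hM.eq_zero x fun f => hinj ?_)
    have := hmin' f x
    rwa [h, map_zero, zero_dvd_iff, ← map_zero (algebraMap R V)] at this
  have h0' : algebraMap R V (f₀ x₀) ≠ 0 := (hinj.ne_iff' (map_zero _)).mpr h0
  obtain ⟨n, hn⟩ := IsDiscreteValuationRing.associated_pow_irreducible h0' hϖ
  have hI : ∀ (f : Module.Dual R M) x, f x ∈ powDvdIdeal R ϖ n := fun f x =>
    mem_powDvdIdeal.mpr (hn.symm.dvd.trans (hmin' f x))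
  obtain ⟨a, ha, hsq⟩ := hArf _ (isIntegrallyClosedIdeal_powDvdIdeal hϖ n)
    ⟨f₀ x₀, hI _ _, mem_nonZeroDivisors_of_ne_zero h0⟩
  have hbb : f₀ x₀ * f₀ x₀ ∈ powDvdIdeal R ϖ n ^ 2 := by
    rw [pow_two]
    exact Ideal.mul_mem_mul (hI _ _) (hI _ _)
  rw [hsq, Ideal.mem_span_singleton_mul] at hbb
  obtain ⟨y, hy, hay⟩ := hbb
  have ha0 : a ≠ 0 := by
    rintro rfl
    rw [zero_mul] at hay
    exact h0 (mul_self_eq_zero.mp hay.symm)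
  obtain ⟨t, ht⟩ := hn.dvd.trans (mem_powDvdIdeal.mp ha)
  let L := FractionRing V
  have hint : IsIntegral R (algebraMap R L a / algebraMap R L (f₀ x₀)) := by
    have hb : algebraMap R L (f₀ x₀) ≠ 0 :=
      ((FaithfulSMul.algebraMap_injective R L).ne_iff' (map_zero _)).mpr h0
    rw [IsScalarTower.algebraMap_apply R V L a, ht, map_mul,
      ← IsScalarTower.algebraMap_apply, mul_div_cancel_left₀ _ hb]
    exact (Algebra.IsIntegral.isIntegral t).algebraMap
  exact ⟨n, hM.nonempty_linearEquiv_of_dvd hind f₀ x₀ h0 hI fun z hz w hw =>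
    dvd_mul_of_sq_eq_span_mul ha ha0 hsq (hI _ _) h0 hint hz hw⟩

theorem nonempty_linearEquiv_powDvdIdeal {R V : Type*} [CommRing R] [CommRing V] [IsDomain V]
    [Algebra R V] [FaithfulSMul R V] {ϖ : V} (hϖ : ϖ ≠ 0) {n : ℕ}
    (h : ∀ y : V, ϖ ^ n ∣ y → y ∈ Set.range (algebraMap R V)) :
    Nonempty (V ≃ₗ[R] powDvdIdeal R ϖ n) := by
  have hinj := FaithfulSMul.algebraMap_injective R V
  obtain ⟨g, hg⟩ := LinearMap.exists_comp_eq_of_range_le (LinearMap.mulLeft R (ϖ ^ n))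
    (Algebra.linearMap R V) hinj (by
      rintro _ ⟨y, rfl⟩
      exact h _ (dvd_mul_right _ _))
  simp only [Algebra.linearMap_apply, LinearMap.mulLeft_apply] at hg
  refine ⟨LinearEquiv.ofBijective (g.codRestrict (powDvdIdeal R ϖ n)
    fun y => mem_powDvdIdeal.mpr (hg y ▸ dvd_mul_right _ _)) ⟨fun x y hxy => ?_, ?_⟩⟩
  · have : g x = g y := congrArg Subtype.val hxy
    refine mul_left_cancel₀ (pow_ne_zero n hϖ) ?_
    rw [← hg, ← hg, this]
  · rintro ⟨z, hz⟩
    obtain ⟨y, hy⟩ := mem_powDvdIdeal.mp hz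
    exact ⟨y, Subtype.ext (hinj ((hg y).trans hy.symm))⟩

theorem isDiscreteValuationRing_integralClosure {R : Type*} [CommRing R] [IsNoetherianRing R]
    [IsDomain R] [Ring.DimensionLEOne R] (hR : ¬ IsField R)
    [IsLocalRing (integralClosure R (FractionRing R))]
    [Module.Finite R (integralClosure R (FractionRing R))] :
    IsDiscreteValuationRing (integralClosure R (FractionRing R)) := by
  have hic : IsIntegrallyClosed (integralClosure R (FractionRing R)) :=
    integralClosure.isIntegrallyClosedOfFiniteExtension (FractionRing R)
  have hnoeth : IsNoetherianRing (integralClosure R (FractionRing R)) :=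
    IsNoetherianRing.of_finite R _
  have hded : IsDedekindDomain (integralClosure R (FractionRing R)) := { }
  have hfield : ¬ IsField (integralClosure R (FractionRing R)) := fun h =>
    hR ((Algebra.IsIntegral.isField_iff_isField
      (FaithfulSMul.algebraMap_injective R (integralClosure R (FractionRing R)))).mpr h)
  exact ((IsDiscreteValuationRing.TFAE _ hfield).out 0 2).mpr hded

theorem exists_forall_dvd_mem_range_algebraMap {R : Type*} [CommRing R] [IsDomain R]
    [Module.Finite R (integralClosure R (FractionRing R))] :
    ∃ d : integralClosure R (FractionRing R), d ≠ 0 ∧ ∀ y, d ∣ y →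
      y ∈ Set.range (algebraMap R (integralClosure R (FractionRing R))) := by
  have hfg : (Subalgebra.toSubmodule (integralClosure R (FractionRing R))).FG :=
    Module.Finite.iff_fg.mp ‹_›
  obtain ⟨d, hd, h⟩ := FractionalIdeal.isFractional_of_fg (S := nonZeroDivisors R) hfg
  refine ⟨algebraMap R _ d, (FaithfulSMul.algebraMap_injective R
    (integralClosure R (FractionRing R))).ne_iff' (map_zero _) |>.mpr
      (nonZeroDivisors.ne_zero hd), ?_⟩
  rintro _ ⟨y, rfl⟩
  obtain ⟨r, hr⟩ := h y y.2
  refine ⟨r, Subtype.ext ?_⟩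
  rw [Algebra.smul_def] at hr
  exact hr

/-- Let `(R, m)` be a one-dimensional Cohen-Macaulay local Arf domain, and suppose that
the integral closure `R̄` of `R` in its fraction field is a local ring and is finitely
generated as an `R`-module. Then there are, up to isomorphism, only finitely many
indecomposable finitely generated reflexive `R`-modules; equivalently, there are only
finitely many isomorphism classes of indecomposable modules `M` fitting in an exact
sequence `0 → M → F → X → 0` with `F` a finitely generated free `R`-module and `X` a
maximal Cohen-Macaulay `R`-module. -/
theorem finitely_many_indecomposable_reflexives {R : Type} [CommRing R] [IsNoetherianRing R]
    [IsLocalRing R] [IsDomain R] (hdim : ringKrullDim R = 1)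
    (hCM : ∃ x ∈ IsLocalRing.maximalIdeal R, x ∈ nonZeroDivisors R)
    (hArf : IsArfRing R)
    (hloc : IsLocalRing ↥(integralClosure R (FractionRing R)))
    (hfin : Module.Finite R ↥(integralClosure R (FractionRing R))) :
    ∃ (n : ℕ) (N : Fin n → Type) (_ : ∀ i, AddCommGroup (N i)) (_ : ∀ i, Module R (N i)),
      (∀ (M : Type) [AddCommGroup M] [Module R M], Module.Finite R M →
        Module.IsReflexive R M → IsIndecomposableModule R M →
        ∃ i, Nonempty (M ≃ₗ[R] N i)) ∧
      (∀ (M : Type) [AddCommGroup M] [Module R M], Module.Finite R M →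
        (∃ (F X : Type) (_ : AddCommGroup F) (_ : Module R F)
            (_ : AddCommGroup X) (_ : Module R X),
          Module.Free R F ∧ Module.Finite R F ∧ IsMCM R X ∧
          ∃ (f : M →ₗ[R] F) (g : F →ₗ[R] X),
            Function.Injective f ∧ Function.Surjective g ∧
            LinearMap.range f = LinearMap.ker g) →
        IsIndecomposableModule R M →
        ∃ i, Nonempty (M ≃ₗ[R] N i)) := by
  have hne : ¬ IsField R := fun h => by
    have := ringKrullDim_eq_zero_of_isField h
    rw [hdim] at this
    exact one_ne_zero this
  have hle : Ring.KrullDimLE 1 R := by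
    rw [Ring.krullDimLE_iff, hdim]
    rfl
  have hdim' : Ring.DimensionLEOne R :=
    ⟨fun {p} hp hprime => Ring.krullDimLE_one_iff_of_isPrime_bot.mp hle p hp hprime⟩
  have hV := isDiscreteValuationRing_integralClosure hne
  obtain ⟨ϖ, hϖ⟩ :=
    IsDiscreteValuationRing.exists_irreducible (integralClosure R (FractionRing R))
  obtain ⟨d, hd0, hd⟩ := exists_forall_dvd_mem_range_algebraMap (R := R)
  obtain ⟨C, hC⟩ := IsDiscreteValuationRing.associated_pow_irreducible hd0 hϖ
  have hlarge : ∀ n, C ≤ n →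
      Nonempty (integralClosure R (FractionRing R) ≃ₗ[R] powDvdIdeal R ϖ n) := fun n hn =>
    nonempty_linearEquiv_powDvdIdeal hϖ.ne_zero fun y hy =>
      hd y (hC.dvd.trans ((pow_dvd_pow ϖ hn).trans hy))
  have key : ∀ (M : Type) [AddCommGroup M] [Module R M], IsDualDivisible R M →
      IsIndecomposableModule R M →
      ∃ i : Fin (C + 1), Nonempty (M ≃ₗ[R] powDvdIdeal R ϖ (i : ℕ)) := by
    intro M _ _ hM hind
    obtain ⟨n, ⟨e⟩⟩ := hM.exists_linearEquiv_powDvdIdeal hArf hϖ hind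
    rcases le_total C n with hn | hn
    · obtain ⟨e₁⟩ := hlarge n hn
      obtain ⟨e₂⟩ := hlarge C le_rfl
      exact ⟨Fin.last C, ⟨e.trans (e₁.symm.trans e₂)⟩⟩
    · exact ⟨⟨n, Nat.lt_succ_of_le hn⟩, ⟨e⟩⟩
  refine ⟨C + 1, fun i => powDvdIdeal R ϖ (i : ℕ), fun i => inferInstance,
    fun i => inferInstance, fun M _ _ _ _ hind => key M .of_isReflexive hind, ?_⟩
  rintro M _ _ - ⟨F, X, _, _, _, _, _, _, hX, f, g, hf, -, hfg⟩ hind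
  exact key M (.of_exact hX.eq_zero_of_smul_eq_zero f g hf hfg) hind
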